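/- Soundness of pruning for ℂ-patterns (Lemma 1 of the paper): let (D_+, D_-) be a labeled database and ℂ a constraint satisfying Conditions C1' and C2'. Let P be a generalized itemset and a a literal not occurring in P such that Sup_-(P) = Sup_-(P + a). Then for every generalized itemset Z with P + a ⊆ Z, if Z ∈ ℂ then Z \ {a} ∈ ℂ. -/

import Mathlib

/-- A generalized itemset (pattern) over an item alphabet `I`:
a set of positive literals and a set of negated items. -/
structure Pattern (I : Type*) where
  pos : Finset I
  neg : Finset I

variable {I : Type*} [Fintype I] [DecidableEq I]

/-- `X` occurs in tuple `t` (`X ⊑ t`): every item of `X.pos` is in `t`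
and no item of `X.neg` is in `t`. -/
def occursIn (X : Pattern I) (t : Finset I) : Prop :=
  (∀ x ∈ X.pos, x ∈ t) ∧ (∀ x ∈ X.neg, x ∉ t)

instance (X : Pattern I) (t : Finset I) : Decidable (occursIn X t) :=
  inferInstanceAs (Decidable (_ ∧ _))

/-- Occurrence list `Occ_D(X) = {t ∈ D : X ⊑ t}`. -/
def Occ (D : Finset (Finset I)) (X : Pattern I) : Finset (Finset I) :=
  D.filter (fun t => occursIn X t)

/-- Support `Sup_D(X) = |Occ_D(X)|`. -/
def supp (D : Finset (Finset I)) (X : Pattern I) : ℕ := (Occ D X).card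

/-- A literal: an item (`inl`) or a negated item (`inr`). -/
abbrev Lit (I : Type*) := I ⊕ I

/-- `P + a`: add literal `a` to pattern `P`. -/
def addLit (P : Pattern I) (a : Lit I) : Pattern I :=
  match a with
  | .inl x => ⟨insert x P.pos, P.neg⟩
  | .inr x => ⟨P.pos, insert x P.neg⟩

/-- `Z \ {a}`: remove literal `a` from pattern `Z`. -/
def removeLit (P : Pattern I) (a : Lit I) : Pattern I :=
  match a with
  | .inl x => ⟨P.pos.erase x, P.neg⟩
  | .inr x => ⟨P.pos, P.neg.erase x⟩

/-- Literal `a` occurs in pattern `P`. -/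
def litMem (a : Lit I) (P : Pattern I) : Prop :=
  match a with
  | .inl x => x ∈ P.pos
  | .inr x => x ∈ P.neg

/-- Pattern inclusion: componentwise inclusion of positive and negated parts. -/
def subPat (P Q : Pattern I) : Prop := P.pos ⊆ Q.pos ∧ P.neg ⊆ Q.neg

/-- Pattern union: componentwise union. -/
def unionPat (P Q : Pattern I) : Pattern I := ⟨P.pos ∪ Q.pos, P.neg ∪ Q.neg⟩

/-- `MIN ℂ`: patterns in `ℂ` with no proper subset in `ℂ`. -/
def MinC (C : Set (Pattern I)) : Set (Pattern I) :=
  {X ∈ C | ∀ Y : Pattern I, subPat Y X → Y ≠ X → Y ∉ C}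

/-- Condition C1'. -/
def CondC1' (Dm : Finset (Finset I)) (C : Set (Pattern I)) : Prop :=
  ∀ (P : Pattern I) (a : Lit I),
    supp Dm P = supp Dm (addLit P a) → addLit P a ∈ C → P ∈ C

/-- Condition C2'. -/
def CondC2' (Dp Dm : Finset (Finset I)) (C : Set (Pattern I)) : Prop :=
  ∀ P Q : Pattern I, Occ Dp P = Occ Dp Q → Occ Dm P = Occ Dm Q → (P ∈ C ↔ Q ∈ C)

/-- Contrast constraint `CP[σ₊, σ₋]`. -/
def CPset (Dp Dm : Finset (Finset I)) (σp σm : ℕ) : Set (Pattern I) :=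
  {X | σp ≤ supp Dp X ∧ supp Dm X ≤ σm}

/-- Growth-rate constraint `GR[θ]` (division-free form). -/
def GRset (Dp Dm : Finset (Finset I)) (θ : ℝ) : Set (Pattern I) :=
  {X | θ * (supp Dm X : ℝ) ≤ (supp Dp X : ℝ)}

omit [Fintype I] [DecidableEq I] in
theorem occursIn.mono {X Y : Pattern I} {t : Finset I} (hXY : subPat X Y)
    (h : occursIn Y t) : occursIn X t :=
  ⟨fun x hx => h.1 x (hXY.1 hx), fun x hx => h.2 x (hXY.2 hx)⟩

omit [Fintype I] in
theorem subPat_addLit (P : Pattern I) (a : Lit I) : subPat P (addLit P a) := by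
  cases a <;> simp [subPat, addLit]

omit [Fintype I] in
theorem litMem_addLit (P : Pattern I) (a : Lit I) : litMem a (addLit P a) := by
  cases a <;> simp [litMem, addLit]

omit [Fintype I] [DecidableEq I] in
theorem litMem.mono {X Y : Pattern I} {a : Lit I} (hXY : subPat X Y) (h : litMem a X) :
    litMem a Y := by
  cases a with
  | inl x => exact hXY.1 h
  | inr x => exact hXY.2 h

omit [Fintype I] in
theorem addLit_removeLit {Z : Pattern I} {a : Lit I} (h : litMem a Z) :
    addLit (removeLit Z a) a = Z := by
  cases a with
  | inl x => simp [addLit, removeLit, Finset.insert_erase (show x ∈ Z.pos from h)]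
  | inr x => simp [addLit, removeLit, Finset.insert_erase (show x ∈ Z.neg from h)]

omit [Fintype I] in
theorem subPat_removeLit {P Z : Pattern I} {a : Lit I} (ha : ¬ litMem a P)
    (h : subPat P Z) : subPat P (removeLit Z a) := by
  cases a with
  | inl x => exact ⟨Finset.subset_erase.2 ⟨h.1, ha⟩, h.2⟩
  | inr x => exact ⟨h.1, Finset.subset_erase.2 ⟨h.2, ha⟩⟩

omit [Fintype I] in
/-- Adding `a` to two patterns constrains a tuple in the same way. -/
theorem occursIn_addLit_of_occursIn_addLit {P X : Pattern I} {a : Lit I} {t : Finset I}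
    (hP : occursIn (addLit P a) t) (hX : occursIn X t) : occursIn (addLit X a) t := by
  cases a with
  | inl x =>
    exact ⟨Finset.forall_mem_insert _ _ _ |>.2 ⟨hP.1 x (Finset.mem_insert_self _ _), hX.1⟩, hX.2⟩
  | inr x =>
    exact ⟨hX.1, Finset.forall_mem_insert _ _ _ |>.2 ⟨hP.2 x (Finset.mem_insert_self _ _), hX.2⟩⟩

theorem Occ_anti (D : Finset (Finset I)) {X Y : Pattern I} (hXY : subPat X Y) :
    Occ D Y ⊆ Occ D X :=
  Finset.monotone_filter_right D fun _ _ h => h.mono hXY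

theorem Occ_addLit_eq_of_supp_eq {D : Finset (Finset I)} {P : Pattern I} {a : Lit I}
    (h : supp D P = supp D (addLit P a)) : Occ D (addLit P a) = Occ D P :=
  Finset.eq_of_subset_of_card_le (Occ_anti D (subPat_addLit P a)) h.le

/-- If adding `a` does not change the support of `P`, it does not change the support
of any pattern containing `P`. -/
theorem supp_addLit_eq_of_subPat {D : Finset (Finset I)} {P X : Pattern I} {a : Lit I}
    (hPX : subPat P X) (h : supp D P = supp D (addLit P a)) :
    supp D X = supp D (addLit X a) := by
  refine congrArg Finset.card (Finset.Subset.antisymm (fun t ht => ?_)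
    (Occ_anti D (subPat_addLit X a)))
  have htP : t ∈ Occ D (addLit P a) := Occ_addLit_eq_of_supp_eq h ▸ Occ_anti D hPX ht
  rw [Occ, Finset.mem_filter] at ht htP ⊢
  exact ⟨ht.1, occursIn_addLit_of_occursIn_addLit htP.2 ht.2⟩

/-- soundness of pruning for ℂ-patterns (Lemma 1). -/
theorem pruning_sound_for_C (Dp Dm : Finset (Finset I)) (C : Set (Pattern I))
    (hC1 : CondC1' Dm C) (hC2 : CondC2' Dp Dm C)
    (P : Pattern I) (a : Lit I) (ha : ¬ litMem a P)
    (h : supp Dm P = supp Dm (addLit P a)) :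
    ∀ Z : Pattern I, subPat (addLit P a) Z → Z ∈ C → removeLit Z a ∈ C := by
  intro Z hZ hZC
  have hPa := subPat_addLit P a
  have hPZ : subPat P (removeLit Z a) :=
    subPat_removeLit ha ⟨hPa.1.trans hZ.1, hPa.2.trans hZ.2⟩
  refine hC1 _ a (supp_addLit_eq_of_subPat hPZ h) ?_
  rwa [addLit_removeLit ((litMem_addLit P a).mono hZ)]
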